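/- There is exactly one positive system P of Δ containing Δ_k⁺ with the following property: the base of P (the set of elements of P that are not the sum of two elements of P) contains exactly one noncompact root ν, and the coefficient of ν in the expansion over the base of P of the highest root of P (the unique β ∈ P such that β + φ ∉ Δ for every φ in the base of P) equals 2. That positive system is Δ⁺, with base {φ₁, φ₂, φ₃, φ₄}, noncompact simple root ν = φ₁, and highest root δ. -/

import Mathlib

noncomputable section

abbrev V : Type := Fin 4 → ℝ

def e (i : Fin 4) : V := Pi.single i 1

/-- The root system of type F₄ in ℝ⁴ (48 vectors). -/
def Δ : Set V :=
  (⋃ i, ({e i, -e i} : Set V)) ∪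
  (⋃ (i) (j) (_ : i < j), ({e i + e j, e i - e j, -e i + e j, -e i - e j} : Set V)) ∪
  {v | ∃ s : Fin 4 → ℝ, (∀ i, s i = 1 ∨ s i = -1) ∧ v = (1 / 2 : ℝ) • ∑ i, s i • e i}

def φ₁ : V := e 1 - e 2
def φ₂ : V := e 2 - e 3
def φ₃ : V := e 3
def φ₄ : V := (1 / 2 : ℝ) • (e 0 - e 1 - e 2 - e 3)

def φv : Fin 4 → V := ![φ₁, φ₂, φ₃, φ₄]

/-- The coordinates `n₁(α), …, n₄(α)` of `α` with respect to the basis φ₁,…,φ₄: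
for every `α : V` one has `α = ∑ i, n α i • φv i`. -/
def n (α : V) : Fin 4 → ℝ :=
  ![α 1 + α 0, α 1 + α 2 + 2 * α 0, α 1 + α 2 + α 3 + 3 * α 0, 2 * α 0]

/-- The highest root δ = 2φ₁+3φ₂+4φ₃+2φ₄ = e₁+e₂. -/
def δ : V := e 0 + e 1

/-- Compact roots: roots α with n₁(α) even. -/
def Δk : Set V := {α ∈ Δ | ∃ m : ℤ, n α 0 = 2 * m}

/-- Noncompact roots: roots α with n₁(α) odd. -/
def Δn : Set V := {α ∈ Δ | ∃ m : ℤ, n α 0 = 2 * m + 1}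

/-- Δ⁺: roots with all φ-coefficients nonnegative. -/
def Δp : Set V := {α ∈ Δ | ∀ i, 0 ≤ n α i}

def Δkp : Set V := Δp ∩ Δk
def Δnp : Set V := Δp ∩ Δn

/-- A positive system of Δ: the set of roots on which some root-regular linear
functional is positive. -/
def IsPosSystem (P : Set V) : Prop :=
  ∃ f : V →ₗ[ℝ] ℝ, (∀ α ∈ Δ, f α ≠ 0) ∧ P = {α ∈ Δ | 0 < f α}

/-- The base of a positive system P: elements of P that are not the sum of two elements of P. -/
def baseOf (P : Set V) : Set V :=
  {α ∈ P | ¬ ∃ β ∈ P, ∃ γ ∈ P, α = β + γ}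

/-- The Borel–de Siebenthal property for a positive system P: the base of P contains
exactly one noncompact root ν, and the coefficient of ν in the expansion over the base
of the highest root of P (the unique β ∈ P with β + φ ∉ Δ for every φ in the base) is 2. -/
def BdS (P : Set V) : Prop :=
  ∃ ν, ν ∈ baseOf P ∧ ν ∈ Δn ∧ (∀ ν', ν' ∈ baseOf P → ν' ∈ Δn → ν' = ν) ∧
  ∃ h, h ∈ P ∧ (∀ φ ∈ baseOf P, h + φ ∉ Δ) ∧
    (∀ h', h' ∈ P → (∀ φ ∈ baseOf P, h' + φ ∉ Δ) → h' = h) ∧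
    ∃ (F : Finset V) (c : V → ℤ),
      ↑F = baseOf P ∧ h = ∑ x ∈ F, (c x : ℝ) • x ∧ c ν = 2

/-- Componentwise comparison, which evaluates much faster than the generic instance. -/
instance : DecidableEq (Fin 4 → ℤ) := fun x y =>
  decidable_of_iff (x 0 = y 0 ∧ x 1 = y 1 ∧ x 2 = y 2 ∧ x 3 = y 3) <| by
    simp [funext_iff, Fin.forall_fin_succ]

/-- The standard pairing on `Fin 4 → ℤ`, written out so that it evaluates fast. -/
def dot (g x : Fin 4 → ℤ) : ℤ := g 0 * x 0 + g 1 * x 1 + g 2 * x 2 + g 3 * x 3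

lemma dot_sub (g x y : Fin 4 → ℤ) : dot g (x - y) = dot g x - dot g y := by
  simp only [dot, Pi.sub_apply]
  ring

lemma dot_neg (g x : Fin 4 → ℤ) : dot g (-x) = -dot g x := by
  simp only [dot, Pi.neg_apply]
  ring

/-- The positive roots of F₄, in coordinates multiplied by 2. -/
def posRootList : List (Fin 4 → ℤ) :=
  [![2, 0, 0, 0], ![0, 2, 0, 0], ![0, 0, 2, 0], ![0, 0, 0, 2],
   ![2, 2, 0, 0], ![2, 0, 2, 0], ![2, 0, 0, 2], ![0, 2, 2, 0], ![0, 2, 0, 2], ![0, 0, 2, 2],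
   ![2, -2, 0, 0], ![2, 0, -2, 0], ![2, 0, 0, -2], ![0, 2, -2, 0], ![0, 2, 0, -2], ![0, 0, 2, -2],
   ![1, 1, 1, 1], ![1, 1, 1, -1], ![1, 1, -1, 1], ![1, 1, -1, -1],
   ![1, -1, 1, 1], ![1, -1, 1, -1], ![1, -1, -1, 1], ![1, -1, -1, -1]]

/-- The roots of F₄, in coordinates multiplied by 2. -/
def rootList : List (Fin 4 → ℤ) := posRootList ++ posRootList.map fun x => -x

/-- Halving, from doubled integer coordinates to `V`. -/
def half : (Fin 4 → ℤ) →+ V where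
  toFun x i := (x i : ℝ) / 2
  map_zero' := by ext; simp
  map_add' x y := by ext; simp [add_div]

lemma half_apply (x : Fin 4 → ℤ) (i : Fin 4) : half x i = (x i : ℝ) / 2 := rfl

lemma half_injective : Function.Injective half := by
  intro x y h
  ext i
  have := congrFun h i
  simp only [half_apply] at this
  exact_mod_cast (div_left_inj' two_ne_zero).1 this

lemma half_single (i : Fin 4) : half (Pi.single i 2) = e i := by
  ext j
  rcases eq_or_ne j i with rfl | h <;> simp [half_apply, e, *]

lemma sum_smul_e (s : Fin 4 → ℝ) : ∑ i, s i • e i = s := by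
  ext j
  simp [e, Finset.sum_apply, Pi.single_apply]

lemma mem_rootList_iff (x : Fin 4 → ℤ) : x ∈ rootList ↔
    (∃ i, x = Pi.single i 2 ∨ x = -Pi.single i 2) ∨
    (∃ i j, i < j ∧ (x = Pi.single i 2 + Pi.single j 2 ∨ x = Pi.single i 2 - Pi.single j 2 ∨
      x = -Pi.single i 2 + Pi.single j 2 ∨ x = -Pi.single i 2 - Pi.single j 2)) ∨
    ∀ i, x i = 1 ∨ x i = -1 := by
  constructor
  · revert x
    decide +kernel
  · rintro (⟨i, rfl | rfl⟩ | ⟨i, j, hij, rfl | rfl | rfl | rfl⟩ | h)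
    iterate 2 revert i; decide +kernel
    iterate 4 revert i j; decide +kernel
    have hx : x = ![x 0, x 1, x 2, x 3] := by ext i; fin_cases i <;> rfl
    rw [hx]
    rcases h 0 with h0 | h0 <;> rcases h 1 with h1 | h1 <;> rcases h 2 with h2 | h2 <;>
      rcases h 3 with h3 | h3 <;> rw [h0, h1, h2, h3] <;> decide +kernel

lemma Δ_eq : Δ = half '' {x | x ∈ rootList} := by
  ext v
  simp only [Δ, Set.mem_union, Set.mem_iUnion, Set.mem_insert_iff, Set.mem_singleton_iff,
    Set.mem_ofPred_eq, Set.mem_image, mem_rootList_iff]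
  constructor
  · rintro ((⟨i, h⟩ | ⟨i, j, hij, h⟩) | ⟨s, hs, rfl⟩)
    · rcases h with rfl | rfl
      · exact ⟨_, .inl ⟨i, .inl rfl⟩, half_single i⟩
      · exact ⟨_, .inl ⟨i, .inr rfl⟩, by rw [map_neg, half_single]⟩
    · rcases h with rfl | rfl | rfl | rfl
      · exact ⟨_, .inr (.inl ⟨i, j, hij, .inl rfl⟩), by simp only [map_add, half_single]⟩
      · exact ⟨_, .inr (.inl ⟨i, j, hij, .inr (.inl rfl)⟩), by simp only [map_sub, half_single]⟩
      · exact ⟨_, .inr (.inl ⟨i, j, hij, .inr (.inr (.inl rfl))⟩),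
          by simp only [map_add, map_neg, half_single]⟩
      · exact ⟨_, .inr (.inl ⟨i, j, hij, .inr (.inr (.inr rfl))⟩),
          by simp only [map_sub, map_neg, half_single]⟩
    · have (i : Fin 4) : ∃ k : ℤ, (k = 1 ∨ k = -1) ∧ (k : ℝ) = s i := by
        rcases hs i with h | h
        · exact ⟨1, .inl rfl, by simp [h]⟩
        · exact ⟨-1, .inr rfl, by simp [h]⟩
      choose k hk hks using this
      refine ⟨k, .inr (.inr hk), ?_⟩
      rw [sum_smul_e]
      ext i
      simp only [half_apply, hks, Pi.smul_apply, smul_eq_mul]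
      ring
  · rintro ⟨x, ⟨i, rfl | rfl⟩ | ⟨i, j, hij, h⟩ | h, rfl⟩
    · exact .inl (.inl ⟨i, .inl (half_single i)⟩)
    · exact .inl (.inl ⟨i, .inr (by rw [map_neg, half_single])⟩)
    · refine .inl (.inr ⟨i, j, hij, ?_⟩)
      rcases h with rfl | rfl | rfl | rfl <;>
        simp only [map_add, map_sub, map_neg, half_single, true_or, or_true]
    · refine .inr ⟨fun i => x i, fun i => ?_, ?_⟩
      · rcases h i with h | h <;> simp [h]
      · rw [sum_smul_e]
        ext i
        simp only [half_apply, Pi.smul_apply, smul_eq_mul]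
        ring

lemma half_mem_Δ {x : Fin 4 → ℤ} : half x ∈ Δ ↔ x ∈ rootList := by
  rw [Δ_eq, half_injective.mem_set_image, Set.mem_ofPred_eq]

/-- The roots on which the integral functional `g` is positive. -/
def posOf (g : Fin 4 → ℤ) : List (Fin 4 → ℤ) := rootList.filter fun x => 0 < dot g x

/-- The indecomposable elements of `posOf g`. The bound on `dot (x - y) (x - y)`, which holds for
all roots, is there to speed up evaluation. -/
def simpleOf (g : Fin 4 → ℤ) : List (Fin 4 → ℤ) :=
  (posOf g).filter fun x => ∀ y ∈ posOf g,
    ¬ (0 < dot g (x - y) ∧ dot (x - y) (x - y) ≤ 8 ∧ x - y ∈ rootList)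

lemma dot_self_le {x : Fin 4 → ℤ} (hx : x ∈ rootList) : dot x x ≤ 8 := by
  revert x
  decide +kernel

lemma mem_posOf {g x : Fin 4 → ℤ} : x ∈ posOf g ↔ x ∈ rootList ∧ 0 < dot g x := by
  simp [posOf]

lemma mem_simpleOf {g x : Fin 4 → ℤ} :
    x ∈ simpleOf g ↔ x ∈ posOf g ∧ ∀ y ∈ posOf g, x - y ∉ posOf g := by
  have (y : Fin 4 → ℤ) : y ∈ posOf g ↔ 0 < dot g y ∧ dot y y ≤ 8 ∧ y ∈ rootList := by
    rw [mem_posOf]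
    exact ⟨fun h => ⟨h.2, dot_self_le h.1, h.1⟩, fun h => ⟨h.2.2, h.1⟩⟩
  simp only [simpleOf, List.mem_filter, decide_eq_true_eq, ← this]

lemma baseOf_half (g : Fin 4 → ℤ) :
    baseOf (half '' {x | x ∈ posOf g}) = half '' {x | x ∈ simpleOf g} := by
  ext v
  simp only [baseOf, Set.mem_ofPred_eq, Set.mem_image, mem_simpleOf]
  constructor
  · rintro ⟨⟨x, hx, rfl⟩, h⟩
    refine ⟨x, ⟨hx, fun y hy hz => h ⟨_, ⟨y, hy, rfl⟩, _, ⟨_, hz, rfl⟩, ?_⟩⟩, rfl⟩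
    rw [← map_add, add_sub_cancel]
  · rintro ⟨x, ⟨hx, h⟩, rfl⟩
    refine ⟨⟨x, hx, rfl⟩, ?_⟩
    rintro ⟨_, ⟨y, hy, rfl⟩, _, ⟨z, hz, rfl⟩, hxyz⟩
    rw [← map_add] at hxyz
    refine h y hy ?_
    rwa [half_injective hxyz, add_sub_cancel_left]

/-- A functional positive on the simple roots of a chamber is positive on the whole chamber. -/
lemma pos_of_pos_simpleOf {g : Fin 4 → ℤ} {f : V →ₗ[ℝ] ℝ}
    (hf : ∀ b ∈ simpleOf g, 0 < f (half b)) {x : Fin 4 → ℤ} (hx : x ∈ posOf g) :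
    0 < f (half x) := by
  induction hm : (dot g x).toNat using Nat.strong_induction_on generalizing x with
  | _ m ih =>
    by_cases hs : x ∈ simpleOf g
    · exact hf x hs
    · simp only [mem_simpleOf, hx, true_and, not_forall, not_not] at hs
      obtain ⟨y, hy, hz⟩ := hs
      have hy' := (mem_posOf.1 hy).2
      have hz' := (mem_posOf.1 hz).2
      have hsub : dot g (x - y) = dot g x - dot g y := dot_sub g x y
      have h1 := ih _ (by omega) hy rfl
      have h2 := ih _ (by omega) hz rfl
      rw [map_sub, map_sub] at h2
      linarith

lemma neg_mem_rootList {x : Fin 4 → ℤ} (hx : x ∈ rootList) : -x ∈ rootList := by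
  revert x
  decide +kernel

lemma posSystem_eq {g : Fin 4 → ℤ} (hg : ∀ x ∈ rootList, dot g x ≠ 0) {f : V →ₗ[ℝ] ℝ}
    (hf : ∀ b ∈ simpleOf g, 0 < f (half b)) :
    {α ∈ Δ | 0 < f α} = half '' {x | x ∈ posOf g} := by
  ext v
  constructor
  · rintro ⟨hv, hfv⟩
    rw [Δ_eq] at hv
    obtain ⟨x, hx, rfl⟩ := hv
    refine ⟨x, mem_posOf.2 ⟨hx, ?_⟩, rfl⟩
    by_contra hneg
    have hlt := lt_of_le_of_ne (not_lt.1 hneg) (hg x hx)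
    have := pos_of_pos_simpleOf hf (x := -x)
      (mem_posOf.2 ⟨neg_mem_rootList hx, by rw [dot_neg]; omega⟩)
    rw [map_neg, map_neg] at this
    linarith
  · rintro ⟨x, hx, rfl⟩
    exact ⟨half_mem_Δ.2 (mem_posOf.1 hx).1, pos_of_pos_simpleOf hf hx⟩

lemma n_half_zero (x : Fin 4 → ℤ) : n (half x) 0 = ((x 0 + x 1 : ℤ) : ℝ) / 2 := by
  simp only [n, half_apply, Matrix.cons_val_zero]
  push_cast
  ring

lemma half_mem_Δn {x : Fin 4 → ℤ} :
    half x ∈ Δn ↔ x ∈ rootList ∧ (x 0 + x 1) % 4 = 2 := by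
  simp only [Δn, Set.mem_ofPred_eq, half_mem_Δ, n_half_zero]
  refine and_congr_right fun _ => ⟨?_, fun h => ⟨(x 0 + x 1) / 4, ?_⟩⟩
  · rintro ⟨m, hm⟩
    have : x 0 + x 1 = 4 * m + 2 := by
      have : ((x 0 + x 1 : ℤ) : ℝ) = 4 * m + 2 := by linarith
      exact_mod_cast this
    omega
  · have : x 0 + x 1 = 4 * ((x 0 + x 1) / 4) + 2 := by omega
    have : ((x 0 + x 1 : ℤ) : ℝ) = 4 * ((x 0 + x 1) / 4 : ℤ) + 2 := by exact_mod_cast this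
    linarith

lemma not_BdS_of_two_noncompact {g : Fin 4 → ℤ}
    (h : ∃ x ∈ simpleOf g, ∃ y ∈ simpleOf g, x ≠ y ∧ (x 0 + x 1) % 4 = 2 ∧ (y 0 + y 1) % 4 = 2) :
    ¬ BdS (half '' {x | x ∈ posOf g}) := by
  obtain ⟨x, hx, y, hy, hxy, hx2, hy2⟩ := h
  rintro ⟨ν, -, -, hν, -⟩
  rw [baseOf_half] at hν
  have key (z) (hz : z ∈ simpleOf g) (hz2 : (z 0 + z 1) % 4 = 2) : half z = ν :=
    hν _ ⟨z, hz, rfl⟩ (half_mem_Δn.2 ⟨(mem_posOf.1 (mem_simpleOf.1 hz).1).1, hz2⟩)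
  exact hxy (half_injective ((key x hx hx2).trans (key y hy hy2).symm))

lemma simpleOf_exceptional : simpleOf ![4, -3, 5, 1] =
    [![0, 0, 0, 2], ![2, 2, 0, 0], ![1, -1, -1, -1], ![-2, 0, 2, 0]] := by
  decide +kernel

lemma eq_of_forall_add_notMem_exceptional : ∀ x ∈ posOf ![4, -3, 5, 1],
    (∀ y ∈ simpleOf ![4, -3, 5, 1], x + y ∉ rootList) → x = ![2, 0, 2, 0] := by
  decide +kernel

/-- The only other chamber with a single noncompact simple root; there its coefficient in the
highest root is 3. -/
lemma not_BdS_exceptional : ¬ BdS (half '' {x | x ∈ posOf ![4, -3, 5, 1]}) := by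
  rintro ⟨ν, hν, hνn, -, h, hh, hmax, -, F, c, hF, hsum, hc⟩
  rw [baseOf_half] at hν hmax hF
  obtain ⟨x, hx, rfl⟩ := hh
  have hx' := eq_of_forall_add_notMem_exceptional x hx fun y hy hxy =>
    hmax (half y) ⟨y, hy, rfl⟩ (by rw [← map_add]; exact half_mem_Δ.2 hxy)
  subst hx'
  obtain ⟨y, hy, rfl⟩ := hν
  have hy2 := (half_mem_Δn.1 hνn).2
  have hy' : y = ![-2, 0, 2, 0] := by
    rw [Set.mem_ofPred_eq, simpleOf_exceptional] at hy
    simp only [List.mem_cons, List.not_mem_nil, or_false] at hy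
    rcases hy with rfl | rfl | rfl | rfl
    all_goals first | rfl | exact absurd hy2 (by decide)
  subst hy'
  let p (i : Fin 4) : V →ₗ[ℝ] ℝ := LinearMap.proj i
  let χ : V →ₗ[ℝ] ℝ := p 0 - p 1 + (2 : ℝ) • p 2
  have hχ (x) : χ (half x) = ((x 0 - x 1 + 2 * x 2 : ℤ) : ℝ) / 2 := by
    simp only [χ, p, LinearMap.add_apply, LinearMap.sub_apply, LinearMap.smul_apply,
      LinearMap.proj_apply, half_apply, smul_eq_mul]
    push_cast
    ring
  have hs := congrArg χ hsum
  rw [map_sum, Finset.sum_eq_single (half ![-2, 0, 2, 0]), map_smul, hχ, hχ, hc] at hs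
  · simp at hs
    norm_num at hs
  · intro b hb hne
    have hb' : b ∈ half '' {x | x ∈ simpleOf ![4, -3, 5, 1]} := hF ▸ hb
    obtain ⟨z, hz, rfl⟩ := hb'
    rw [Set.mem_ofPred_eq, simpleOf_exceptional] at hz
    simp only [List.mem_cons, List.not_mem_nil, or_false] at hz
    rw [map_smul, hχ]
    rcases hz with rfl | rfl | rfl | rfl
    iterate 3 simp
    exact absurd rfl hne
  · intro hn
    exact absurd (Finset.mem_coe.1 (hF ▸ ⟨_, hy, rfl⟩)) hn

/-- The doubled coordinates of the simple roots `φ₁, φ₂, φ₃, φ₄`. -/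
def simpleRoot : Fin 4 → Fin 4 → ℤ :=
  ![![0, 2, -2, 0], ![0, 0, 2, -2], ![0, 0, 0, 2], ![1, -1, -1, -1]]

lemma half_simpleRoot (i : Fin 4) : half (simpleRoot i) = φv i := by
  ext j
  fin_cases i <;> fin_cases j <;>
    simp [half_apply, simpleRoot, φv, φ₁, φ₂, φ₃, φ₄, e] <;> norm_num

lemma mem_simpleOf_standard {x : Fin 4 → ℤ} :
    x ∈ simpleOf ![7, 3, 2, 1] ↔ ∃ i, simpleRoot i = x := by
  have h1 : ∀ x ∈ simpleOf ![7, 3, 2, 1], ∃ i, simpleRoot i = x := by decide +kernel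
  have h2 : ∀ i, simpleRoot i ∈ simpleOf ![7, 3, 2, 1] := by decide +kernel
  exact ⟨h1 x, by rintro ⟨i, rfl⟩; exact h2 i⟩

lemma Δp_eq : Δp = half '' {x | x ∈ posOf ![7, 3, 2, 1]} := by
  have key : ∀ x ∈ rootList, (0 ≤ x 1 + x 0 ∧ 0 ≤ x 1 + x 2 + 2 * x 0 ∧
      0 ≤ x 1 + x 2 + x 3 + 3 * x 0 ∧ 0 ≤ x 0) ↔ 0 < dot ![7, 3, 2, 1] x := by
    decide +kernel
  have hn (x : Fin 4 → ℤ) : (∀ i, 0 ≤ n (half x) i) ↔ (0 ≤ x 1 + x 0 ∧ 0 ≤ x 1 + x 2 + 2 * x 0 ∧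
      0 ≤ x 1 + x 2 + x 3 + 3 * x 0 ∧ 0 ≤ x 0) := by
    simp only [← Int.cast_nonneg_iff (R := ℝ), Fin.forall_fin_succ, n, half_apply]
    simp
    refine and_congr ?_ (and_congr ?_ (and_congr ?_ ?_)) <;> constructor <;> intro h <;>
      first | linarith | (rify at h ⊢; linarith)
  ext v
  simp only [Δp, Set.mem_ofPred_eq, Set.mem_image, mem_posOf]
  constructor
  · rintro ⟨hv, h⟩
    rw [Δ_eq] at hv
    obtain ⟨x, hx, rfl⟩ := hv
    exact ⟨x, ⟨hx, (key x hx).1 ((hn x).1 h)⟩, rfl⟩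
  · rintro ⟨x, ⟨hx, h⟩, rfl⟩
    exact ⟨half_mem_Δ.2 hx, (hn x).2 ((key x hx).2 h)⟩

lemma baseOf_Δp : baseOf Δp = Set.range φv := by
  rw [Δp_eq, baseOf_half]
  ext v
  simp only [Set.mem_image, Set.mem_ofPred_eq, mem_simpleOf_standard, Set.mem_range,
    ← half_simpleRoot]
  constructor
  · rintro ⟨_, ⟨i, rfl⟩, rfl⟩
    exact ⟨i, rfl⟩
  · rintro ⟨i, rfl⟩
    exact ⟨_, ⟨i, rfl⟩, rfl⟩

lemma φv_mem_Δn_iff (i : Fin 4) : φv i ∈ Δn ↔ i = 0 := by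
  rw [← half_simpleRoot, half_mem_Δn]
  revert i
  decide +kernel

lemma φv_injective : Function.Injective φv := by
  have h : Function.Injective simpleRoot := by decide +kernel
  intro i j hij
  rw [← half_simpleRoot, ← half_simpleRoot] at hij
  exact h (half_injective hij)

lemma half_highest : half ![2, 2, 0, 0] = δ := by
  ext j
  fin_cases j <;> norm_num [half_apply, δ, e]

lemma δ_mem_Δp : δ ∈ Δp := by
  rw [Δp_eq, ← half_highest, half_injective.mem_set_image]
  decide +kernel

lemma forall_add_notMem_iff {v : V} (hv : v ∈ Δp) :
    (∀ φ ∈ baseOf Δp, v + φ ∉ Δ) ↔ v = δ := by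
  have key : ∀ x ∈ posOf ![7, 3, 2, 1],
      (∀ i, x + simpleRoot i ∉ rootList) ↔ x = ![2, 2, 0, 0] := by
    decide +kernel
  rw [Δp_eq] at hv
  obtain ⟨x, hx, rfl⟩ := hv
  rw [baseOf_Δp, Set.forall_mem_range, ← half_highest, half_injective.eq_iff, ← key x hx]
  simp only [← half_simpleRoot, ← map_add, half_mem_Δ]

lemma isPosSystem_Δp : IsPosSystem Δp := by
  let f : V →ₗ[ℝ] ℝ := (7 : ℝ) • LinearMap.proj 0 + (3 : ℝ) • LinearMap.proj 1 +
    (2 : ℝ) • LinearMap.proj 2 + LinearMap.proj 3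
  have hf (x) : f (half x) = ((7 * x 0 + 3 * x 1 + 2 * x 2 + x 3 : ℤ) : ℝ) / 2 := by
    simp only [f, LinearMap.add_apply, LinearMap.smul_apply, LinearMap.proj_apply, half_apply,
      smul_eq_mul]
    push_cast
    ring
  refine ⟨f, ?_, ?_⟩
  · intro α hα
    rw [Δ_eq] at hα
    obtain ⟨x, hx, rfl⟩ := hα
    have : ∀ x ∈ rootList, 7 * x 0 + 3 * x 1 + 2 * x 2 + x 3 ≠ 0 := by decide +kernel
    rw [hf]
    exact div_ne_zero (Int.cast_ne_zero.2 (this x hx)) two_ne_zero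
  · rw [Δp_eq, posSystem_eq (g := ![7, 3, 2, 1]) (by decide +kernel)]
    intro b hb
    have : ∀ b ∈ simpleOf ![7, 3, 2, 1], 0 < 7 * b 0 + 3 * b 1 + 2 * b 2 + b 3 := by
      decide +kernel
    rw [hf]
    exact half_pos (Int.cast_pos.2 (this b hb))

lemma δ_eq_sum : δ = ∑ i, ((![2, 3, 4, 2] : Fin 4 → ℤ) i : ℝ) • φv i := by
  ext j
  fin_cases j <;>
    simp [Fin.sum_univ_four, δ, φv, φ₁, φ₂, φ₃, φ₄, e] <;> norm_num

lemma BdS_Δp : BdS Δp := by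
  classical
  refine ⟨φv 0, ?_, (φv_mem_Δn_iff 0).2 rfl, ?_, δ, δ_mem_Δp,
    (forall_add_notMem_iff δ_mem_Δp).2 rfl, fun h' hh' => (forall_add_notMem_iff hh').1,
    Finset.univ.image φv, Function.extend φv ![2, 3, 4, 2] 0, ?_, ?_, ?_⟩
  · rw [baseOf_Δp]
    exact ⟨0, rfl⟩
  · rw [baseOf_Δp]
    rintro _ ⟨i, rfl⟩ hi
    rw [(φv_mem_Δn_iff i).1 hi]
  · rw [baseOf_Δp, Finset.coe_image, Finset.coe_univ, Set.image_univ]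
  · rw [Finset.sum_image φv_injective.injOn]
    simp only [φv_injective.extend_apply]
    exact δ_eq_sum
  · rw [φv_injective.extend_apply]
    rfl

lemma half_mem_Δkp {x : Fin 4 → ℤ} (hx : x ∈ posOf ![7, 3, 2, 1]) (h : (x 0 + x 1) % 4 = 0) :
    half x ∈ Δkp := by
  refine ⟨Δp_eq ▸ ⟨x, hx, rfl⟩, half_mem_Δ.2 (mem_posOf.1 hx).1, (x 0 + x 1) / 4, ?_⟩
  have : x 0 + x 1 = 4 * ((x 0 + x 1) / 4) := by omega
  have : ((x 0 + x 1 : ℤ) : ℝ) = 4 * ((x 0 + x 1) / 4 : ℤ) := by exact_mod_cast this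
  rw [n_half_zero]
  linarith

lemma apply_half (f : V →ₗ[ℝ] ℝ) (x : Fin 4 → ℤ) : f (half x) =
    (x 0 * f (e 0) + x 1 * f (e 1) + x 2 * f (e 2) + x 3 * f (e 3)) / 2 := by
  rw [← sum_smul_e (half x), map_sum]
  simp only [map_smul, smul_eq_mul, half_apply, Fin.sum_univ_four]
  ring

set_option maxHeartbeats 1000000 in
lemma eq_Δp_of_BdS {P : Set V} (hP : IsPosSystem P) (hk : Δkp ⊆ P) (hB : BdS P) : P = Δp := by
  obtain ⟨f, hf, rfl⟩ := hP
  have hpos (x) (hx : x ∈ posOf ![7, 3, 2, 1]) (h : (x 0 + x 1) % 4 = 0) :=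
    (hk (half_mem_Δkp hx h)).2
  have hne (x) (hx : x ∈ rootList) := hf _ (half_mem_Δ.2 hx)
  have p1 := hpos ![2, 2, 0, 0] (by decide +kernel) rfl
  have p2 := hpos ![0, 0, 2, -2] (by decide +kernel) rfl
  have p3 := hpos ![0, 0, 0, 2] (by decide +kernel) rfl
  have p4 := hpos ![1, -1, -1, -1] (by decide +kernel) rfl
  have q1 := hne ![0, 2, -2, 0] (by decide +kernel)
  have q2 := hne ![0, 2, 0, -2] (by decide +kernel)
  have q3 := hne ![0, 2, 0, 0] (by decide +kernel)
  have q4 := hne ![0, 2, 0, 2] (by decide +kernel)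
  have q5 := hne ![0, 2, 2, 0] (by decide +kernel)
  have q6 := hne ![1, 1, -1, -1] (by decide +kernel)
  have q7 := hne ![1, 1, -1, 1] (by decide +kernel)
  have q8 := hne ![2, 0, -2, 0] (by decide +kernel)
  have absurd_of_simpleOf (g : Fin 4 → ℤ) (S : List (Fin 4 → ℤ)) (hS : simpleOf g = S)
      (hg : ∀ x ∈ rootList, dot g x ≠ 0)
      (h2 : ∃ x ∈ S, ∃ y ∈ S, x ≠ y ∧ (x 0 + x 1) % 4 = 2 ∧ (y 0 + y 1) % 4 = 2)
      (hp : ∀ b ∈ S, 0 < f (half b)) : False := by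
    subst hS
    exact not_BdS_of_two_noncompact h2 (posSystem_eq hg hp ▸ hB)
  simp only [apply_half, Matrix.cons_val, Int.cast_zero, Int.cast_one, Int.cast_neg,
    Int.cast_ofNat] at p1 p2 p3 p4 q1 q2 q3 q4 q5 q6 q7 q8
  have pos4 (a b c d : Fin 4 → ℤ)
      (ha : 0 < a 0 * f (e 0) + a 1 * f (e 1) + a 2 * f (e 2) + a 3 * f (e 3))
      (hb : 0 < b 0 * f (e 0) + b 1 * f (e 1) + b 2 * f (e 2) + b 3 * f (e 3))
      (hc : 0 < c 0 * f (e 0) + c 1 * f (e 1) + c 2 * f (e 2) + c 3 * f (e 3))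
      (hd : 0 < d 0 * f (e 0) + d 1 * f (e 1) + d 2 * f (e 2) + d 3 * f (e 3)) :
      ∀ x ∈ [a, b, c, d], 0 < f (half x) := by
    simp only [List.forall_mem_cons, apply_half]
    exact ⟨half_pos ha, half_pos hb, half_pos hc, half_pos hd, by simp⟩
  rcases lt_or_gt_of_ne q1 with r1 | r1
  · rcases lt_or_gt_of_ne q2 with r2 | r2
    · rcases lt_or_gt_of_ne q3 with r3 | r3
      · rcases lt_or_gt_of_ne q4 with r4 | r4
        · rcases lt_or_gt_of_ne q5 with r5 | r5
          · rcases lt_or_gt_of_ne q6 with r6 | r6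
            · rcases lt_or_gt_of_ne q7 with r7 | r7
              · refine (absurd_of_simpleOf ![5, -4, 3, 1]
                  [![0, 0, 0, 2], ![2, 2, 0, 0], ![0, -2, -2, 0], ![-1, -1, 1, -1]]
                  (by decide +kernel) (by decide +kernel) (by decide +kernel) ?_).elim
                apply pos4 <;> simp <;> linarith
              · refine (absurd_of_simpleOf ![5, -3, 2, 1]
                  [![0, 0, 2, -2], ![1, 1, -1, 1], ![0, -2, -2, 0], ![-1, -1, 1, 1]]
                  (by decide +kernel) (by decide +kernel) (by decide +kernel) ?_).elim
                apply pos4 <;> simp <;> linarith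
            · refine (absurd_of_simpleOf ![7, -3, 2, 1]
                [![0, 0, 0, 2], ![0, 0, 2, -2], ![1, 1, -1, -1], ![0, -2, -2, 0]]
                (by decide +kernel) (by decide +kernel) (by decide +kernel) ?_).elim
              apply pos4 <;> simp <;> linarith
          · rcases lt_or_gt_of_ne q6 with r6 | r6
            · rcases lt_or_gt_of_ne q7 with r7 | r7
              · rcases lt_or_gt_of_ne q8 with r8 | r8
                · refine (not_BdS_exceptional
                    (posSystem_eq (g := ![4, -3, 5, 1]) (by decide +kernel) ?_ ▸ hB)).elim
                  rw [simpleOf_exceptional]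
                  apply pos4 <;> simp <;> linarith
                · refine (absurd_of_simpleOf ![5, -3, 4, 1]
                    [![0, 0, 0, 2], ![0, 2, 2, 0], ![2, 0, -2, 0], ![-1, -1, 1, -1]]
                    (by decide +kernel) (by decide +kernel) (by decide +kernel) ?_).elim
                  apply pos4 <;> simp <;> linarith
              · refine (absurd_of_simpleOf ![5, -2, 3, 1]
                  [![0, 2, 2, 0], ![1, 1, -1, 1], ![0, -2, 0, -2], ![-1, -1, 1, 1]]
                  (by decide +kernel) (by decide +kernel) (by decide +kernel) ?_).elim
                apply pos4 <;> simp <;> linarith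
            · refine (absurd_of_simpleOf ![7, -2, 3, 1]
                [![0, 0, 0, 2], ![0, 2, 2, 0], ![1, 1, -1, -1], ![0, -2, 0, -2]]
                (by decide +kernel) (by decide +kernel) (by decide +kernel) ?_).elim
              apply pos4 <;> simp <;> linarith
        · rcases lt_or_gt_of_ne q6 with r6 | r6
          · refine (absurd_of_simpleOf ![5, -1, 3, 2]
              [![0, 2, 0, 2], ![0, 0, 2, -2], ![1, -1, -1, -1], ![-1, -1, 1, 1]]
              (by decide +kernel) (by decide +kernel) (by decide +kernel) ?_).elim
            apply pos4 <;> simp <;> linarith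
          · refine (absurd_of_simpleOf ![7, -1, 3, 2]
              [![0, 2, 0, 2], ![0, 0, 2, -2], ![1, 1, -1, -1], ![0, -2, 0, 0]]
              (by decide +kernel) (by decide +kernel) (by decide +kernel) ?_).elim
            apply pos4 <;> simp <;> linarith
      · refine (absurd_of_simpleOf ![7, 1, 3, 2]
          [![0, 2, 0, 0], ![0, 0, 2, -2], ![1, -1, -1, -1], ![0, -2, 0, 2]]
          (by decide +kernel) (by decide +kernel) (by decide +kernel) ?_).elim
        apply pos4 <;> simp <;> linarith
    · refine (absurd_of_simpleOf ![7, 2, 3, 1]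
        [![0, 0, 0, 2], ![0, 2, 0, -2], ![1, -1, -1, -1], ![0, -2, 2, 0]]
        (by decide +kernel) (by decide +kernel) (by decide +kernel) ?_).elim
      apply pos4 <;> simp <;> linarith
  · rw [Δp_eq]
    refine posSystem_eq (by decide +kernel) fun b hb => ?_
    obtain ⟨i, rfl⟩ := mem_simpleOf_standard.1 hb
    rw [apply_half]
    fin_cases i <;> simp [simpleRoot] <;> linarith

theorem stmt19 :
    (∃! P : Set V, IsPosSystem P ∧ Δkp ⊆ P ∧ BdS P) ∧
    IsPosSystem Δp ∧ Δkp ⊆ Δp ∧ BdS Δp ∧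
    baseOf Δp = ({φ₁, φ₂, φ₃, φ₄} : Set V) ∧
    φ₁ ∈ Δn ∧
    δ ∈ Δp ∧ (∀ φ ∈ baseOf Δp, δ + φ ∉ Δ) := by
  refine ⟨⟨Δp, ⟨isPosSystem_Δp, Set.inter_subset_left, BdS_Δp⟩, ?_⟩, isPosSystem_Δp,
    Set.inter_subset_left, BdS_Δp, ?_, (φv_mem_Δn_iff 0).2 rfl, δ_mem_Δp,
    (forall_add_notMem_iff δ_mem_Δp).2 rfl⟩
  · rintro P ⟨hP, hk, hB⟩
    exact eq_Δp_of_BdS hP hk hB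
  · rw [baseOf_Δp]
    ext v
    simp [φv]
    tauto
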